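/- Let d ≥ 1. Let H : ℝ^d × ℝ^d → ℝ and G : ℝ^d → ℝ be C² with uniformly bounded second order derivatives, with H(x,·) convex for every x, and uniformly strongly convex in p (there is μ > 0 with wᵀ ∂_{pp}H(x,p) w ≥ μ|w|² for all x, p, w). Then there exists a constant C > 0, depending only on the uniform bound on D²G, the uniform bound on D²H, and μ, such that for every α > C the following holds: setting H̃(x,p) := H(x,p) − (α/2)|x|², there exists β ∈ ℝ such that the function x ↦ H̃(x, p − βx) is concave on ℝ^d for every p, the function p ↦ H̃(x, p − βx) is convex on ℝ^d for every x, and the function x ↦ G(x) + (β/2)|x|² is convex on ℝ^d. -/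

import Mathlib

open Set

/-- `w ↦ wᵀ ∂_{xx}H(x,p) w`: the quadratic form of the second-derivative block of `H`
in the first (state) variable, expressed via the second iterated Fréchet derivative. -/
noncomputable def Qxx (d : ℕ)
    (H : EuclideanSpace ℝ (Fin d) × EuclideanSpace ℝ (Fin d) → ℝ)
    (x p w : EuclideanSpace ℝ (Fin d)) : ℝ :=
  iteratedFDeriv ℝ 2 H (x, p) ![(w, 0), (w, 0)]

/-- `w ↦ wᵀ ∂_{pp}H(x,p) w`: the quadratic form of the second-derivative block of `H`
in the second (momentum) variable. -/
noncomputable def Qpp (d : ℕ)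
    (H : EuclideanSpace ℝ (Fin d) × EuclideanSpace ℝ (Fin d) → ℝ)
    (x p w : EuclideanSpace ℝ (Fin d)) : ℝ :=
  iteratedFDeriv ℝ 2 H (x, p) ![(0, w), (0, w)]

/-- `w ↦ wᵀ (Re ∂_{xp}H(x,p)) w`: the quadratic form of the symmetrized mixed
second-derivative block of `H`, where `Re A = (A + Aᵀ)/2`. -/
noncomputable def Qxp (d : ℕ)
    (H : EuclideanSpace ℝ (Fin d) × EuclideanSpace ℝ (Fin d) → ℝ)
    (x p w : EuclideanSpace ℝ (Fin d)) : ℝ :=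
  (1 / 2) * (iteratedFDeriv ℝ 2 H (x, p) ![(w, 0), (0, w)] +
    iteratedFDeriv ℝ 2 H (x, p) ![(0, w), (w, 0)])

/-- The root `r₊(x,p,w)` of the quadratic polynomial
`α ↦ wᵀ∂_{xx}H w - 2α wᵀ(Re ∂_{xp}H) w + α² wᵀ∂_{pp}H w`. -/
noncomputable def rplus (d : ℕ)
    (H : EuclideanSpace ℝ (Fin d) × EuclideanSpace ℝ (Fin d) → ℝ)
    (x p w : EuclideanSpace ℝ (Fin d)) : ℝ :=
  (Qxp d H x p w +
      Real.sqrt ((Qxp d H x p w) ^ 2 - Qpp d H x p w * Qxx d H x p w)) /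
    Qpp d H x p w

/-- The root `r₋(x,p,w)` of the quadratic polynomial
`α ↦ wᵀ∂_{xx}H w - 2α wᵀ(Re ∂_{xp}H) w + α² wᵀ∂_{pp}H w`. -/
noncomputable def rminus (d : ℕ)
    (H : EuclideanSpace ℝ (Fin d) × EuclideanSpace ℝ (Fin d) → ℝ)
    (x p w : EuclideanSpace ℝ (Fin d)) : ℝ :=
  (Qxp d H x p w -
      Real.sqrt ((Qxp d H x p w) ^ 2 - Qpp d H x p w * Qxx d H x p w)) /
    Qpp d H x p w

/-- The derivative of a `C²` function with second derivative bounded by `K` is `K`-Lipschitz. -/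
theorem norm_fderiv_sub_le_of_norm_iteratedFDeriv_two_le {F : Type*} [NormedAddCommGroup F]
    [NormedSpace ℝ F] {f : F → ℝ} {K : ℝ} (hf : ContDiff ℝ 2 f)
    (hK : ∀ z, ‖iteratedFDeriv ℝ 2 f z‖ ≤ K) (y z : F) :
    ‖fderiv ℝ f z - fderiv ℝ f y‖ ≤ K * ‖z - y‖ := by
  have hd : ContDiff ℝ 1 (fderiv ℝ f) := hf.fderiv_right (by norm_num)
  refine convex_univ.norm_image_sub_le_of_norm_fderiv_le (𝕜 := ℝ)
    (fun x _ => (hd.differentiable one_ne_zero) x) (fun x _ => ?_) (mem_univ y) (mem_univ z)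
  rw [← norm_iteratedFDeriv_one, norm_iteratedFDeriv_fderiv]
  exact hK x

/-- A function is convex as soon as its restrictions to all lines are convex. -/
theorem convexOn_univ_of_lines {E : Type*} [AddCommGroup E] [Module ℝ E] {f : E → ℝ}
    (h : ∀ x v : E, ConvexOn ℝ univ (fun t : ℝ => f (x + t • v))) : ConvexOn ℝ univ f := by
  refine ⟨convex_univ, fun x _ y _ a b ha hb hab => ?_⟩
  have key := (h x (y - x)).2 (mem_univ 0) (mem_univ 1) ha hb hab
  have hx : x + b • (y - x) = a • x + b • y := by
    obtain rfl : a = 1 - b := by linarith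
    module
  simpa [hx] using key

/-- If the second derivative of `f` is bounded by `K`, then the composition of `f` with an affine
map of linear part `L` becomes convex after adding `(a / 2) * ‖x‖ ^ 2`, when `K * M ^ 2 ≤ a` for
a bound `M` of `L`. -/
theorem convexOn_comp_affine_add_sq {E F : Type*} [NormedAddCommGroup E]
    [InnerProductSpace ℝ E] [NormedAddCommGroup F] [NormedSpace ℝ F] {f : F → ℝ} {K M a : ℝ}
    (hf : ContDiff ℝ 2 f) (hK : ∀ z, ‖iteratedFDeriv ℝ 2 f z‖ ≤ K) (L : E →L[ℝ] F)
    (hL : ∀ w, ‖L w‖ ≤ M * ‖w‖) (ha : K * M ^ 2 ≤ a) (c : F) :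
    ConvexOn ℝ univ (fun x : E => f (L x + c) + (a / 2) * ‖x‖ ^ 2) := by
  refine convexOn_univ_of_lines fun x v => ?_
  have hK0 : 0 ≤ K := (norm_nonneg _).trans (hK 0)
  have hline : ∀ t : ℝ, HasDerivAt (fun t : ℝ => x + t • v) v t := fun t => by
    simpa using ((hasDerivAt_id t).smul_const v).const_add x
  have hderiv : ∀ t : ℝ, HasDerivAt
      (fun t : ℝ => f (L (x + t • v) + c) + (a / 2) * ‖x + t • v‖ ^ 2)
      (fderiv ℝ f (L (x + t • v) + c) (L v) + (a / 2) * (2 * inner ℝ (x + t • v) v)) t := by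
    intro t
    have h1 : HasDerivAt (fun t : ℝ => L (x + t • v) + c) (L v) t :=
      (L.hasFDerivAt.comp_hasDerivAt t (hline t)).add_const c
    have h2 := ((hf.differentiable two_ne_zero) (L (x + t • v) + c)).hasFDerivAt.comp_hasDerivAt
      t h1
    exact h2.add ((hline t).norm_sq.const_mul (a / 2))
  refine Monotone.convexOn_univ_of_deriv (fun t => (hderiv t).differentiableAt) ?_
  intro s t hst
  rw [(hderiv s).deriv, (hderiv t).deriv]
  have hts : 0 ≤ t - s := sub_nonneg.2 hst
  have hsub : L (x + t • v) + c - (L (x + s • v) + c) = (t - s) • L v := by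
    simp only [map_add, map_smul]
    module
  have hbound : |fderiv ℝ f (L (x + t • v) + c) (L v) - fderiv ℝ f (L (x + s • v) + c) (L v)|
      ≤ K * (t - s) * ‖L v‖ ^ 2 := by
    have h1 := norm_fderiv_sub_le_of_norm_iteratedFDeriv_two_le hf hK
      (L (x + s • v) + c) (L (x + t • v) + c)
    rw [hsub, norm_smul, Real.norm_of_nonneg hts] at h1
    have h2 := ContinuousLinearMap.le_of_opNorm_le _ h1 (L v)
    rw [sub_apply, Real.norm_eq_abs] at h2
    linarith
  have hLv : K * (t - s) * ‖L v‖ ^ 2 ≤ a * (t - s) * ‖v‖ ^ 2 :=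
    calc K * (t - s) * ‖L v‖ ^ 2 ≤ K * (t - s) * (M * ‖v‖) ^ 2 := by gcongr; exact hL v
      _ = K * M ^ 2 * ((t - s) * ‖v‖ ^ 2) := by ring
      _ ≤ a * ((t - s) * ‖v‖ ^ 2) := by gcongr
      _ = a * (t - s) * ‖v‖ ^ 2 := by ring
  have hinner : ∀ r : ℝ, inner ℝ (x + r • v) v = inner ℝ x v + r * ‖v‖ ^ 2 := fun r => by
    rw [inner_add_left, real_inner_smul_left, real_inner_self_eq_norm_sq]
  rw [hinner, hinner]
  linarith [(abs_le.1 hbound).1]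

/-- (Convexification content of Corollary 1.2(2).) For every bound `KG`
on `D²G`, bound `KH` on `D²H` and strong convexity constant `μ > 0`, there is a constant
`C > 0` depending only on `(KG, KH, μ)` such that: for every such `H`, `G` and every
`α > C`, setting `H̃(x,p) = H(x,p) - (α/2)|x|²`, there exists `β ∈ ℝ` with
`x ↦ H̃(x, p - βx)` concave for every `p`, `p ↦ H̃(x, p - βx)` convex for every `x`, and
`x ↦ G(x) + (β/2)|x|²` convex. -/
theorem corollary_main_two (d : ℕ) (hd : 1 ≤ d) (KG KH μ : ℝ) (hμ : 0 < μ) :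
    ∃ C : ℝ, 0 < C ∧
      ∀ (H : EuclideanSpace ℝ (Fin d) × EuclideanSpace ℝ (Fin d) → ℝ)
        (G : EuclideanSpace ℝ (Fin d) → ℝ),
        ContDiff ℝ 2 H →
        (∀ z, ‖iteratedFDeriv ℝ 2 H z‖ ≤ KH) →
        ContDiff ℝ 2 G →
        (∀ x, ‖iteratedFDeriv ℝ 2 G x‖ ≤ KG) →
        (∀ x : EuclideanSpace ℝ (Fin d),
          ConvexOn ℝ Set.univ (fun p : EuclideanSpace ℝ (Fin d) => H (x, p))) →
        (∀ x p w : EuclideanSpace ℝ (Fin d), μ * ‖w‖ ^ 2 ≤ Qpp d H x p w) →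
        ∀ α : ℝ, C < α →
          ∃ β : ℝ,
            (∀ p : EuclideanSpace ℝ (Fin d),
              ConcaveOn ℝ Set.univ (fun x : EuclideanSpace ℝ (Fin d) =>
                H (x, p - β • x) - (α / 2) * ‖x‖ ^ 2)) ∧
            (∀ x : EuclideanSpace ℝ (Fin d),
              ConvexOn ℝ Set.univ (fun p : EuclideanSpace ℝ (Fin d) =>
                H (x, p - β • x) - (α / 2) * ‖x‖ ^ 2)) ∧
            ConvexOn ℝ Set.univ
              (fun x : EuclideanSpace ℝ (Fin d) => G x + (β / 2) * ‖x‖ ^ 2) := by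
  refine ⟨|KH| * (1 + |KG|) ^ 2 + 1, by positivity, ?_⟩
  intro H G hH hKH hG hKG hconv _ α hα
  refine ⟨KG, fun p => ?_, fun x => ?_, ?_⟩
  · let L : EuclideanSpace ℝ (Fin d) →L[ℝ] EuclideanSpace ℝ (Fin d) × EuclideanSpace ℝ (Fin d) :=
      (ContinuousLinearMap.id ℝ _).prod (-KG • ContinuousLinearMap.id ℝ _)
    have hL : ∀ w, ‖L w‖ ≤ (1 + |KG|) * ‖w‖ := by
      intro w
      refine max_le ?_ ?_
      · change ‖w‖ ≤ _
        nlinarith [norm_nonneg w, abs_nonneg KG]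
      · change ‖-KG • w‖ ≤ _
        rw [norm_smul, norm_neg, Real.norm_eq_abs]
        nlinarith [norm_nonneg w, abs_nonneg KG]
    have hneg : ∀ z, ‖iteratedFDeriv ℝ 2 (-H) z‖ ≤ |KH| := fun z => by
      rw [iteratedFDeriv_neg_apply, norm_neg]
      exact (hKH z).trans (le_abs_self KH)
    have key := convexOn_comp_affine_add_sq (a := α) hH.neg hneg L hL (by linarith) (0, p)
    refine neg_convexOn_iff.1 (key.congr fun x _ => ?_)
    have hx : L x + (0, p) = (x, p - KG • x) := by
      refine Prod.ext (add_zero x) ?_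
      change -KG • x + p = p - KG • x
      module
    simp only [hx, Pi.neg_apply]
    ring
  · have h := (hconv x).translate_left (-(KG • x))
    refine (h.add_const (-((α / 2) * ‖x‖ ^ 2))).congr fun p _ => ?_
    simp only [Pi.add_apply, Function.comp_apply, sub_eq_add_neg]
  · simpa using convexOn_comp_affine_add_sq (M := 1) (a := KG) hG hKG
      (ContinuousLinearMap.id ℝ _) (by simp) (by simp) 0
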